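/- Let ξ be a normal random variable with mean μ and variance σ² > 0. Then E[ξ · N(ξ)] = μ · N( μ / √(1 + σ²) ) + (σ² / √(1 + σ²)) · N′( μ / √(1 + σ²) ), where N is the standard normal cumulative distribution function and N′ its density. -/

import Mathlib

open MeasureTheory Real ProbabilityTheory

/-- The standard normal cumulative distribution function. -/
noncomputable def stdNormalCDF (z : ℝ) : ℝ :=
  ∫ u in Set.Iic z, (Real.sqrt (2 * Real.pi))⁻¹ * Real.exp (-u ^ 2 / 2)

/-- The standard normal density. -/
noncomputable def stdNormalPDF (z : ℝ) : ℝ :=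
  (Real.sqrt (2 * Real.pi))⁻¹ * Real.exp (-z ^ 2 / 2)

lemma stdNormalPDF_eq_gaussianPDFReal : stdNormalPDF = gaussianPDFReal 0 1 := by
  ext x
  simp [stdNormalPDF, gaussianPDFReal]

lemma integrable_stdNormalPDF : Integrable stdNormalPDF := by
  rw [stdNormalPDF_eq_gaussianPDFReal]
  exact integrable_gaussianPDFReal 0 1

lemma continuous_stdNormalPDF : Continuous stdNormalPDF := by
  unfold stdNormalPDF
  fun_prop

lemma stdNormalCDF_eq_gaussianReal (z : ℝ) :
    stdNormalCDF z = (gaussianReal 0 1).real (Set.Iic z) := by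
  have h : stdNormalCDF z = ∫ u in Set.Iic z, gaussianPDFReal 0 1 u := by
    rw [← stdNormalPDF_eq_gaussianPDFReal]
    rfl
  rw [h, measureReal_def, gaussianReal_apply_eq_integral 0 one_ne_zero, ENNReal.toReal_ofReal]
  exact integral_nonneg fun x ↦ gaussianPDFReal_nonneg 0 1 x

lemma abs_stdNormalCDF_le_one (z : ℝ) : |stdNormalCDF z| ≤ 1 := by
  rw [stdNormalCDF_eq_gaussianReal, abs_of_nonneg measureReal_nonneg]
  exact measureReal_le_one

lemma hasDerivAt_stdNormalCDF (z : ℝ) : HasDerivAt stdNormalCDF (stdNormalPDF z) z := by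
  have h : stdNormalCDF = fun x ↦ (∫ u in (0 : ℝ)..x, stdNormalPDF u) + stdNormalCDF 0 := by
    ext x
    rw [← intervalIntegral.integral_Iic_sub_Iic integrable_stdNormalPDF.integrableOn
      integrable_stdNormalPDF.integrableOn]
    simp only [stdNormalCDF, stdNormalPDF]
    ring
  rw [h]
  exact (continuous_stdNormalPDF.integral_hasStrictDerivAt 0 z).hasDerivAt.add_const _

lemma continuous_stdNormalCDF : Continuous stdNormalCDF :=
  continuous_iff_continuousAt.2 fun z ↦ (hasDerivAt_stdNormalCDF z).continuousAt

lemma MeasureTheory.Integrable.mul_stdNormalCDF {P : Measure ℝ} {f : ℝ → ℝ} (hf : Integrable f P) :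
    Integrable (fun x ↦ f x * stdNormalCDF x) P :=
  hf.mul_bdd (c := 1) continuous_stdNormalCDF.aestronglyMeasurable
    (Filter.Eventually.of_forall abs_stdNormalCDF_le_one)

lemma integrable_sub_mean_gaussianReal (μ : ℝ) (v : NNReal) :
    Integrable (fun x ↦ x - μ) (gaussianReal μ v) :=
  ((memLp_id_gaussianReal 1).integrable (by simp)).sub (integrable_const μ)

lemma gaussianReal_Iic_zero (μ : ℝ) {v : NNReal} (hv : v ≠ 0) :
    (gaussianReal (-μ) v).real (Set.Iic 0) = stdNormalCDF (μ / √v) := by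
  have hs : 0 < √(v : ℝ) := Real.sqrt_pos.2 (by positivity)
  have h := gaussianReal_map_const_mul (μ := -(μ / √v)) (v := 1) (√v)
  have h' := gaussianReal_map_add_const (μ := 0) (v := 1) (-(μ / √v))
  rw [zero_add] at h'
  rw [← h', Measure.map_map (by fun_prop) (by fun_prop)] at h
  have hvar : (NNReal.mk (√(v : ℝ) ^ 2) (sq_nonneg _) * 1 : NNReal) = v := by
    ext
    simp
  have hmean : √(v : ℝ) * -(μ / √v) = -μ := by field_simp
  rw [hvar, hmean] at h
  rw [← h, stdNormalCDF_eq_gaussianReal, map_measureReal_apply (by fun_prop) measurableSet_Iic]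
  congr 1
  ext x
  simp only [Set.mem_preimage, Set.mem_Iic, Function.comp_apply]
  rw [← sub_eq_add_neg, ← smul_eq_mul, smul_nonpos_iff_nonpos_of_pos_left hs, sub_nonpos]

lemma integral_stdNormalCDF_gaussianReal (μ : ℝ) (v : NNReal) :
    ∫ x, stdNormalCDF x ∂(gaussianReal μ v) = stdNormalCDF (μ / √(1 + v)) := by
  have hconv : gaussianReal (-μ) v ∗ gaussianReal 0 1 = gaussianReal (-μ) (v + 1) := by
    rw [gaussianReal_conv_gaussianReal, add_zero]
  have hmeas : Measurable fun x ↦ gaussianReal 0 1 (Set.Iic x) :=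
    Monotone.measurable fun _ _ hxy ↦ measure_mono (Set.Iic_subset_Iic.2 hxy)
  have hmass : gaussianReal (-μ) (v + 1) (Set.Iic 0)
      = ∫⁻ x, gaussianReal 0 1 (Set.Iic x) ∂(gaussianReal μ v) := by
    rw [← hconv, ← lintegral_indicator_one measurableSet_Iic,
      Measure.lintegral_conv (measurable_one.indicator measurableSet_Iic), ← gaussianReal_map_neg]
    have hsection (x : ℝ) : ∫⁻ y, (Set.Iic (0 : ℝ)).indicator 1 (x + y) ∂(gaussianReal 0 1)
        = gaussianReal 0 1 (Set.Iic (-x)) := by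
      rw [← lintegral_indicator_one measurableSet_Iic]
      congr with y
      simp [Set.indicator_apply, le_neg_iff_add_nonpos_left]
    simp_rw [hsection]
    rw [lintegral_map (f := fun x ↦ gaussianReal 0 1 (Set.Iic (-x)))
      (hmeas.comp measurable_neg) measurable_neg]
    simp
  simp_rw [stdNormalCDF_eq_gaussianReal, measureReal_def]
  rw [integral_toReal hmeas.aemeasurable (Filter.Eventually.of_forall fun x ↦ measure_lt_top _ _),
    ← hmass, ← measureReal_def, gaussianReal_Iic_zero μ (by positivity),
    stdNormalCDF_eq_gaussianReal, measureReal_def, NNReal.coe_add, NNReal.coe_one, add_comm]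

lemma gaussianPDFReal_mul_stdNormalPDF (μ : ℝ) {v : NNReal} (hv : v ≠ 0) (x : ℝ) :
    gaussianPDFReal μ v x * stdNormalPDF x
      = (√(1 + v))⁻¹ * stdNormalPDF (μ / √(1 + v))
        * gaussianPDFReal (μ / (1 + v)) (v / (1 + v)) x := by
  have hv' : (0 : ℝ) < v := by positivity
  have hw : (0 : ℝ) < 1 + v := by positivity
  have hexp : -(x - μ) ^ 2 / (2 * v) + -x ^ 2 / 2
      = -(μ / √(1 + v)) ^ 2 / 2 + -(x - μ / (1 + v)) ^ 2 / (2 * (v / (1 + v))) := by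
    rw [div_pow, Real.sq_sqrt hw.le]
    field_simp
    ring
  have hconst : √(2 * π * v) = √(1 + v) * √(2 * π * (v / (1 + v))) := by
    rw [← Real.sqrt_mul hw.le]
    congr 1
    field_simp
  simp only [gaussianPDFReal, stdNormalPDF, NNReal.coe_div, NNReal.coe_add, NNReal.coe_one]
  calc _ = (√(2 * π * v))⁻¹ * (√(2 * π))⁻¹
        * rexp (-(x - μ) ^ 2 / (2 * v) + -x ^ 2 / 2) := by rw [Real.exp_add]; ring
    _ = _ := by rw [hexp, hconst, Real.exp_add, mul_inv]; ring

lemma integral_stdNormalPDF_gaussianReal (μ : ℝ) {v : NNReal} (hv : v ≠ 0) :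
    ∫ x, stdNormalPDF x ∂(gaussianReal μ v) = (√(1 + v))⁻¹ * stdNormalPDF (μ / √(1 + v)) := by
  rw [integral_gaussianReal_eq_integral_smul hv]
  simp_rw [smul_eq_mul, gaussianPDFReal_mul_stdNormalPDF μ hv]
  rw [integral_const_mul, integral_gaussianPDFReal_eq_one _ (by positivity), mul_one]

lemma hasDerivAt_gaussianPDFReal (μ : ℝ) {v : NNReal} (hv : v ≠ 0) (x : ℝ) :
    HasDerivAt (gaussianPDFReal μ v) (-((x - μ) / v * gaussianPDFReal μ v x)) x := by
  have hv' : (v : ℝ) ≠ 0 := by positivity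
  have h := ((((((hasDerivAt_id x).sub_const μ).pow 2).neg).div_const (2 * (v : ℝ))).exp).const_mul
    (√(2 * π * v))⁻¹
  refine h.congr_deriv ?_
  simp only [gaussianPDFReal, id, Pi.pow_apply, Pi.neg_apply]
  field_simp
  simp

/-- Gaussian integration by parts (Stein's identity) for the standard normal distribution
function. -/
lemma integral_sub_mean_mul_stdNormalCDF_gaussianReal (μ : ℝ) {v : NNReal} (hv : v ≠ 0) :
    ∫ x, (x - μ) * stdNormalCDF x ∂(gaussianReal μ v)
      = v * ∫ x, stdNormalPDF x ∂(gaussianReal μ v) := by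
  have hv' : (v : ℝ) ≠ 0 := by positivity
  have hp := integrable_gaussianPDFReal μ v
  have hid := integrable_sub_mean_gaussianReal μ v
  have hxp : Integrable fun x ↦ (x - μ) * gaussianPDFReal μ v x := by
    rw [gaussianReal_of_var_ne_zero μ hv,
      integrable_withDensity_iff (measurable_gaussianPDF μ v)
        (Filter.Eventually.of_forall fun _ ↦ gaussianPDF_lt_top)] at hid
    simpa only [toReal_gaussianPDF] using hid
  have hibp := integral_mul_deriv_eq_deriv_mul_of_integrable
    (u := stdNormalCDF) (v := gaussianPDFReal μ v) (u' := stdNormalPDF)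
    (v' := fun x ↦ -((x - μ) / v * gaussianPDFReal μ v x))
    (fun x _ ↦ hasDerivAt_stdNormalCDF x) (fun x _ ↦ hasDerivAt_gaussianPDFReal μ hv x)
    ((hxp.mul_stdNormalCDF.const_mul (-(v : ℝ)⁻¹)).congr
      (Filter.Eventually.of_forall fun x ↦ by simp only [Pi.mul_apply]; ring))
    (((integrable_gaussianPDFReal (μ / (1 + v)) (v / (1 + v))).const_mul
        ((√(1 + v))⁻¹ * stdNormalPDF (μ / √(1 + v)))).congr
      (Filter.Eventually.of_forall fun x ↦ by
        simp only [Pi.mul_apply]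
        rw [← gaussianPDFReal_mul_stdNormalPDF μ hv, mul_comm]))
    (hp.mul_stdNormalCDF.congr (Filter.Eventually.of_forall fun x ↦ mul_comm _ _))
  rw [integral_gaussianReal_eq_integral_smul hv, integral_gaussianReal_eq_integral_smul hv]
  simp_rw [smul_eq_mul, mul_comm (gaussianPDFReal μ v _) (stdNormalPDF _)]
  rw [← neg_eq_iff_eq_neg] at hibp
  rw [← hibp, ← integral_neg, ← integral_const_mul]
  congr with x
  field_simp

/-- For `ξ` normal with mean `μ` and variance `σ² > 0`,
`E[ξ N(ξ)] = μ N(μ/√(1+σ²)) + (σ²/√(1+σ²)) N'(μ/√(1+σ²))`. -/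
theorem gaussian_expectation_id_mul_cdf (μ σ : ℝ) (hσ : 0 < σ) :
    ∫ x, x * stdNormalCDF x ∂(gaussianReal μ (Real.toNNReal (σ ^ 2)))
      = μ * stdNormalCDF (μ / Real.sqrt (1 + σ ^ 2))
        + σ ^ 2 / Real.sqrt (1 + σ ^ 2) * stdNormalPDF (μ / Real.sqrt (1 + σ ^ 2)) := by
  have hv : Real.toNNReal (σ ^ 2) ≠ 0 := (Real.toNNReal_pos.2 (by positivity)).ne'
  have hcoe : (Real.toNNReal (σ ^ 2) : ℝ) = σ ^ 2 := Real.coe_toNNReal _ (sq_nonneg σ)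
  have hid : Integrable (fun x ↦ x - μ) (gaussianReal μ (Real.toNNReal (σ ^ 2))) :=
    integrable_sub_mean_gaussianReal μ _
  have hsplit (x : ℝ) : x * stdNormalCDF x = (x - μ) * stdNormalCDF x + μ * stdNormalCDF x := by
    ring
  simp_rw [hsplit]
  rw [integral_add hid.mul_stdNormalCDF (integrable_const μ).mul_stdNormalCDF,
    integral_sub_mean_mul_stdNormalCDF_gaussianReal μ hv, integral_stdNormalPDF_gaussianReal μ hv,
    integral_const_mul, integral_stdNormalCDF_gaussianReal, hcoe]
  ring
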